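/- Let T be an m-accretive operator on a complex Hilbert space H with closed range and let S be a bounded accretive operator on H such that R(S) ⊆ R(T) and ‖T†S‖ < 1. Then: R(T + S) = R(T) is closed; N(T + S) = N(T); T + S is an EP operator; and the Moore-Penrose inverse of T + S is given by (T + S)† = (I + T†S)⁻¹ T† = T† (I + S T†)⁻¹; in particular T† = (T + S)† (I + S T†). -/

import Mathlib

open scoped ComplexInnerProductSpace
noncomputable section

variable {H : Type*} [NormedAddCommGroup H] [InnerProductSpace ℂ H] [CompleteSpace H]

/-- The range of a partially defined operator, as a submodule of `H`. -/
def pRange (T : H →ₗ.[ℂ] H) : Submodule ℂ H := LinearMap.range T.toFun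

/-- The kernel of a partially defined operator, as a submodule of `H`. -/
def pKer (T : H →ₗ.[ℂ] H) : Submodule ℂ H := (LinearMap.ker T.toFun).map T.domain.subtype

/-- An operator `T` is accretive if `Re ⟨T x, x⟩ ≥ 0` for all `x` in its domain. -/
def PAccretive (T : H →ₗ.[ℂ] H) : Prop := ∀ x : T.domain, 0 ≤ (⟪(x : H), T x⟫).re

/-- `T` is m-accretive: accretive, densely defined, closed, and `R(μ + T) = H` for all `μ > 0`. -/
def MAccretive (T : H →ₗ.[ℂ] H) : Prop :=
  PAccretive T ∧ Dense (T.domain : Set H) ∧ IsClosed (T.graph : Set (H × H)) ∧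
    ∀ μ : ℝ, 0 < μ → ∀ y : H, ∃ x : T.domain, (μ : ℂ) • (x : H) + T x = y

/-- `T` is sectorial with vertex `0` and semiangle `ω` (ω-accretive):
`W(T) ⊆ {z : |arg z| ≤ ω}`. -/
def SectorialP (T : H →ₗ.[ℂ] H) (ω : ℝ) : Prop :=
  ∀ x : T.domain, ‖(x : H)‖ = 1 → |(⟪(x : H), T x⟫).arg| ≤ ω

/-- `y` is the orthogonal projection of `x` onto the closure of `M`. -/
def IsProjOnto (M : Submodule ℂ H) (x y : H) : Prop :=
  y ∈ M.topologicalClosure ∧ x - y ∈ Mᗮ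

/-- `Td` is the Moore-Penrose inverse of `T`: a closed densely defined operator with
domain `R(T) ⊕ R(T)ᗮ` such that `T Td T = T` on `D(T)`, `Td T Td = Td` on `D(Td)`,
`T Td = P_{cl R(T)}` on `D(Td)` and `Td T = P_{N(T)ᗮ}` on `D(T)`. -/
structure IsMoorePenroseInverse (T Td : H →ₗ.[ℂ] H) : Prop where
  closed' : IsClosed (Td.graph : Set (H × H))
  dense' : Dense (Td.domain : Set H)
  domain_eq : Td.domain = pRange T ⊔ (pRange T)ᗮ
  tdt : ∀ x : T.domain, ∃ (h1 : T x ∈ Td.domain) (h2 : Td ⟨T x, h1⟩ ∈ T.domain),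
    T ⟨Td ⟨T x, h1⟩, h2⟩ = T x
  dtd : ∀ x : Td.domain, ∃ (h1 : Td x ∈ T.domain) (h2 : T ⟨Td x, h1⟩ ∈ Td.domain),
    Td ⟨T ⟨Td x, h1⟩, h2⟩ = Td x
  proj_range : ∀ x : Td.domain, ∃ h1 : Td x ∈ T.domain,
    IsProjOnto (pRange T) (x : H) (T ⟨Td x, h1⟩)
  proj_ker : ∀ x : T.domain, ∃ h1 : T x ∈ Td.domain,
    IsProjOnto ((pKer T)ᗮ) (x : H) (Td ⟨T x, h1⟩)

/-- A bounded everywhere-defined operator viewed as a partially defined operator. -/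
def clmToPMap (S : H →L[ℂ] H) : H →ₗ.[ℂ] H := S.toLinearMap.toPMap ⊤

/-- A partially defined operator is bounded if it is bounded on its domain. -/
def BoundedPMap (T : H →ₗ.[ℂ] H) : Prop := ∃ C : ℝ, ∀ x : T.domain, ‖T x‖ ≤ C * ‖(x : H)‖

/-- `T Td = Td T` on `D(T)`. -/
def CommutesOnDomain (T Td : H →ₗ.[ℂ] H) : Prop :=
  ∀ x : T.domain, ∃ (h1 : (x : H) ∈ Td.domain) (h2 : Td ⟨(x : H), h1⟩ ∈ T.domain)
    (h3 : T x ∈ Td.domain), T ⟨Td ⟨(x : H), h1⟩, h2⟩ = Td ⟨T x, h3⟩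

/-- `T` is an EP operator: its Moore-Penrose inverse is bounded and `T T† = T† T` on `D(T)`. -/
def IsEPPMap (T : H →ₗ.[ℂ] H) : Prop :=
  ∃ Td : H →ₗ.[ℂ] H, IsMoorePenroseInverse T Td ∧ BoundedPMap Td ∧ CommutesOnDomain T Td

/-- The sum `T + S` of a partially defined operator and a bounded operator, with domain `D(T)`. -/
def addB (T : H →ₗ.[ℂ] H) (S : H →L[ℂ] H) : H →ₗ.[ℂ] H :=
  ⟨T.domain, T.toFun + S.toLinearMap.comp T.domain.subtype⟩

/-- The sum of two partially defined operators, with domain `D(A) ∩ D(B)`. -/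
def pAdd (A B : H →ₗ.[ℂ] H) : H →ₗ.[ℂ] H :=
  ⟨A.domain ⊓ B.domain,
    A.toFun.comp (Submodule.inclusion inf_le_left) +
      B.toFun.comp (Submodule.inclusion inf_le_right)⟩

/-- The difference of two partially defined operators, with domain `D(A) ∩ D(B)`. -/
def pSub (A B : H →ₗ.[ℂ] H) : H →ₗ.[ℂ] H :=
  ⟨A.domain ⊓ B.domain,
    A.toFun.comp (Submodule.inclusion inf_le_left) -
      B.toFun.comp (Submodule.inclusion inf_le_right)⟩

/-- The operator `-A - r` on `D(A)`. -/
def negShift (A : H →ₗ.[ℂ] H) (r : ℝ) : H →ₗ.[ℂ] H :=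
  ⟨A.domain, -A.toFun - (r : ℂ) • A.domain.subtype⟩

/-- The composition `B ∘ A` of a bounded operator with a partially defined one. -/
def compB (B : H →L[ℂ] H) (A : H →ₗ.[ℂ] H) : H →ₗ.[ℂ] H :=
  ⟨A.domain, B.toLinearMap.comp A.toFun⟩

/-- `T2` is the square `T ∘ T` of `T`, with domain `{x ∈ D(T) : T x ∈ D(T)}`. -/
def IsSquareOf (T T2 : H →ₗ.[ℂ] H) : Prop :=
  (∀ x : T2.domain, ∃ (h1 : (x : H) ∈ T.domain) (h2 : T ⟨(x : H), h1⟩ ∈ T.domain),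
      T2 x = T ⟨T ⟨(x : H), h1⟩, h2⟩) ∧
  ∀ x : H, x ∈ T2.domain ↔ ∃ h : x ∈ T.domain, T ⟨x, h⟩ ∈ T.domain

/-- The reduced minimum modulus `γ(T) = inf {‖T x‖ : x ∈ N(T)ᗮ ∩ D(T), ‖x‖ = 1}`. -/
def gammaP (T : H →ₗ.[ℂ] H) : ℝ :=
  sInf {r | ∃ x : T.domain, (x : H) ∈ (pKer T)ᗮ ∧ ‖(x : H)‖ = 1 ∧ r = ‖T x‖}

/-- The spectrum of a partially defined operator: the complement of the set of `μ` for which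
`μ - A` has an everywhere-defined bounded inverse. -/
def pSpectrum (A : H →ₗ.[ℂ] H) : Set ℂ :=
  {μ | ¬ ∃ B : H →L[ℂ] H, (∀ x : A.domain, B (μ • (x : H) - A x) = (x : H)) ∧
        ∀ y : H, ∃ h : B y ∈ A.domain, μ • B y - A ⟨B y, h⟩ = y}

/-- The numerical radius of a partially defined operator. -/
def pNumRad (A : H →ₗ.[ℂ] H) : ℝ :=
  sSup {r | ∃ x : A.domain, ‖(x : H)‖ = 1 ∧ r = ‖⟪(x : H), A x⟫‖}

/-- `B` is an everywhere-defined bounded inverse of the partially defined operator `A`. -/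
def IsBoundedInverseOf (A : H →ₗ.[ℂ] H) (B : H →L[ℂ] H) : Prop :=
  (∀ x : A.domain, B (A x) = (x : H)) ∧ ∀ y : H, ∃ h : B y ∈ A.domain, A ⟨B y, h⟩ = y

/-- The real part `(T + T*)/2` of a bounded operator. -/
def reOp (T : H →L[ℂ] H) : H →L[ℂ] H := (2 : ℂ)⁻¹ • (T + ContinuousLinearMap.adjoint T)

/-- The imaginary part `(T - T*)/(2i)` of a bounded operator. -/
def imOp (T : H →L[ℂ] H) : H →L[ℂ] H :=
  (2 * Complex.I)⁻¹ • (T - ContinuousLinearMap.adjoint T)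

/-- A bounded operator is accretive if `Re ⟨T x, x⟩ ≥ 0` for all `x`. -/
def CAccretive (T : H →L[ℂ] H) : Prop := ∀ x : H, 0 ≤ (⟪x, T x⟫).re

/-- A bounded operator is sectorial with vertex `0` and semiangle `ω` if
`W(T) ⊆ {z : |arg z| ≤ ω}`. -/
def Sectorial (T : H →L[ℂ] H) (ω : ℝ) : Prop :=
  ∀ x : H, ‖x‖ = 1 → |(⟪x, T x⟫).arg| ≤ ω

/-- The numerical radius `w(T) = sup {|⟨T x, x⟩| : ‖x‖ = 1}` of a bounded operator. -/
def numRad (T : H →L[ℂ] H) : ℝ := sSup {r | ∃ x : H, ‖x‖ = 1 ∧ r = ‖⟪x, T x⟫‖}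

/-- Jacobson's lemma: if `1 + a b` is invertible, so is `1 + b a`. -/
theorem isUnit_one_add_mul_comm {R : Type*} [Ring R] {a b : R} (h : IsUnit (1 + a * b)) :
    IsUnit (1 + b * a) := by
  obtain ⟨u, hu⟩ := h
  have h1 : a * b = u - 1 := by rw [hu, add_sub_cancel_left]
  refine ⟨⟨1 + b * a, 1 - b * ↑u⁻¹ * a, ?_, ?_⟩, rfl⟩
  · calc _ = 1 + b * a - b * ↑u⁻¹ * a - b * (a * b) * ↑u⁻¹ * a := by noncomm_ring
      _ = 1 + b * a - b * (u * ↑u⁻¹) * a := by rw [h1]; noncomm_ring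
      _ = 1 := by rw [u.mul_inv]; noncomm_ring
  · calc _ = 1 + b * a - b * ↑u⁻¹ * a - b * ↑u⁻¹ * (a * b) * a := by noncomm_ring
      _ = 1 + b * a - b * (↑u⁻¹ * u) * a := by rw [h1]; noncomm_ring
      _ = 1 := by rw [u.inv_mul]; noncomm_ring

omit [CompleteSpace H] in
theorem mem_pRange {T : H →ₗ.[ℂ] H} (x : T.domain) : T x ∈ pRange T := ⟨x, rfl⟩

omit [CompleteSpace H] in
theorem mem_pKer {T : H →ₗ.[ℂ] H} {x : H} :
    x ∈ pKer T ↔ ∃ h : x ∈ T.domain, T ⟨x, h⟩ = 0 := by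
  constructor
  · rintro ⟨y, hy, rfl⟩
    exact ⟨y.2, hy⟩
  · rintro ⟨h, hx⟩
    exact ⟨⟨x, h⟩, hx, rfl⟩

omit [CompleteSpace H] in
theorem clmToPMap_apply (C : H →L[ℂ] H) (x : (clmToPMap C).domain) :
    clmToPMap C x = C x := rfl

omit [CompleteSpace H] in
theorem mem_domain_clmToPMap (C : H →L[ℂ] H) (x : H) : x ∈ (clmToPMap C).domain :=
  Submodule.mem_top

omit [CompleteSpace H] in
theorem addB_apply (T : H →ₗ.[ℂ] H) (S : H →L[ℂ] H) (x : T.domain) :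
    addB T S x = T x + S x := rfl

omit [CompleteSpace H] in
theorem isClosed_graph_clmToPMap (C : H →L[ℂ] H) :
    IsClosed ((clmToPMap C).graph : Set (H × H)) := by
  have : ((clmToPMap C).graph : Set (H × H)) = {p | C p.1 = p.2} := by
    ext p
    simp only [SetLike.mem_coe, LinearPMap.mem_graph_iff, Set.mem_ofPred_eq]
    constructor
    · rintro ⟨y, h1, h2⟩
      rw [← h1, ← h2, clmToPMap_apply]
    · intro h
      exact ⟨⟨p.1, mem_domain_clmToPMap C _⟩, rfl, h⟩
  rw [this]
  exact isClosed_eq (by fun_prop) (by fun_prop)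

/-- A real number `a` with `0 ≤ t a + t² c` for all real `t` is zero. -/
theorem eq_zero_of_forall_nonneg {a c : ℝ} (h : ∀ t : ℝ, 0 ≤ t * a + t ^ 2 * c) : a = 0 := by
  have hd := discrim_le_zero (a := c) (b := a) (c := 0) fun t => by
    have := h t
    nlinarith
  simp only [discrim, mul_zero, sub_zero] at hd
  exact pow_eq_zero_iff two_ne_zero |>.1 (le_antisymm hd (sq_nonneg a))

omit [CompleteSpace H] in
/-- The kernel of an accretive operator is orthogonal to its range. -/
theorem PAccretive.inner_eq_zero {T : H →ₗ.[ℂ] H} (hT : PAccretive T) {x : T.domain}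
    (hx : T x = 0) (y : T.domain) : ⟪(x : H), T y⟫ = 0 := by
  have key (y : T.domain) : (⟪(x : H), T y⟫).re = 0 := by
    refine eq_zero_of_forall_nonneg (c := (⟪(y : H), T y⟫).re) fun t => ?_
    have h := hT (x + (t : ℂ) • y)
    rw [LinearPMap.map_add, LinearPMap.map_smul, hx, zero_add] at h
    simp only [Submodule.coe_add, Submodule.coe_smul, inner_add_left, inner_smul_left,
      inner_smul_right, Complex.conj_ofReal, Complex.add_re, Complex.re_ofReal_mul] at h
    nlinarith
  apply Complex.ext
  · exact key y
  · have h := key (Complex.I • y)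
    rw [LinearPMap.map_smul, inner_smul_right] at h
    simpa using h

omit [CompleteSpace H] in
/-- An m-accretive operator has kernel equal to the orthogonal complement of its range. -/
theorem MAccretive.pKer_eq {T : H →ₗ.[ℂ] H} (hT : MAccretive T) : pKer T = (pRange T)ᗮ := by
  ext z
  rw [mem_pKer]
  constructor
  · rintro ⟨h, hz⟩
    rw [Submodule.mem_orthogonal']
    rintro _ ⟨y, rfl⟩
    exact hT.1.inner_eq_zero hz y
  · intro hz
    obtain ⟨x, hx⟩ := hT.2.2.2 1 one_pos z
    have h0 : ⟪z, T x⟫ = 0 := (Submodule.mem_orthogonal' _ _).1 hz _ (mem_pRange x)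
    simp only [Complex.ofReal_one, one_smul] at hx
    have h1 := hT.1 x
    have h2 : (⟪T x, T x⟫).re = ‖T x‖ ^ 2 := by
      rw [inner_self_eq_norm_sq_to_K]; norm_cast
    rw [← hx, inner_add_left] at h0
    have h3 := congrArg Complex.re h0
    rw [Complex.add_re, h2, Complex.zero_re] at h3
    have h4 : T x = 0 := by
      rw [← norm_eq_zero]
      nlinarith [sq_nonneg ‖T x‖]
    rw [h4, add_zero] at hx
    subst hx
    exact ⟨x.2, h4⟩

omit [CompleteSpace H] in
/-- A bounded accretive operator vanishes on the orthogonal complement of its range. -/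
theorem CAccretive.apply_eq_zero {S : H →L[ℂ] H} (hS : CAccretive S) {z : H}
    (hz : ∀ y, ⟪z, S y⟫ = 0) : S z = 0 := by
  have h : (⟪S z, S z⟫).re = 0 := by
    refine eq_zero_of_forall_nonneg (c := (⟪S z, S (S z)⟫).re) fun t => ?_
    have h := hS (z + (t : ℂ) • S z)
    simp only [map_add, map_smul, inner_add_left, inner_add_right, hz, inner_smul_left,
      inner_smul_right, Complex.conj_ofReal, Complex.add_re, Complex.re_ofReal_mul,
      Complex.zero_re] at h
    nlinarith
  have h2 : (⟪S z, S z⟫).re = ‖S z‖ ^ 2 := by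
    rw [inner_self_eq_norm_sq_to_K]; norm_cast
  rw [h2] at h
  exact norm_eq_zero.1 (pow_eq_zero_iff two_ne_zero |>.1 h)

omit [CompleteSpace H] in
theorem eq_of_sub_mem_orthogonal {R : Submodule ℂ H} {a b : H} (ha : a ∈ R) (hb : b ∈ R)
    (h : a - b ∈ Rᗮ) : a = b := by
  have h0 := Submodule.inner_right_of_mem_orthogonal (R.sub_mem ha hb) h
  exact sub_eq_zero.1 (inner_self_eq_zero.1 h0)

/-- If `N(A) = R(A)ᗮ` with `R(A)` closed, and both `A C` and `C A` act as the orthogonal projection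
onto `R(A)`, then `C` is the Moore-Penrose inverse of `A` and `A C = C A` on `D(A)`. -/
theorem isMoorePenroseInverse_of_proj {A : H →ₗ.[ℂ] H} {C : H →L[ℂ] H}
    (hcl : IsClosed (pRange A : Set H)) (hker : pKer A = (pRange A)ᗮ)
    (hdom : ∀ y, C y ∈ A.domain) (hran : ∀ y, C y ∈ pRange A)
    (hAC : ∀ y, y - A ⟨C y, hdom y⟩ ∈ (pRange A)ᗮ)
    (hCA : ∀ x : A.domain, (x : H) - C (A x) ∈ (pRange A)ᗮ) :
    IsMoorePenroseInverse A (clmToPMap C) ∧ CommutesOnDomain A (clmToPMap C) := by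
  have : CompleteSpace (pRange A) := hcl.completeSpace_coe
  refine ⟨⟨isClosed_graph_clmToPMap C, dense_univ, ?_, fun x => ?_, fun x => ?_, fun x => ?_,
    fun x => ?_⟩, fun x => ?_⟩
  · rw [Submodule.sup_orthogonal_of_hasOrthogonalProjection]
    rfl
  · exact ⟨mem_domain_clmToPMap C _, hdom _,
      (eq_of_sub_mem_orthogonal (mem_pRange x) (mem_pRange _) (hAC (A x))).symm⟩
  · exact ⟨hdom _, mem_domain_clmToPMap C _,
      (eq_of_sub_mem_orthogonal (hran _) (hran _) (hCA ⟨C x, hdom x⟩)).symm⟩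
  · exact ⟨hdom _, Submodule.le_topologicalClosure _ (mem_pRange _), hAC x⟩
  · refine ⟨mem_domain_clmToPMap C _, Submodule.le_topologicalClosure _ ?_, ?_⟩
    · rw [hker, Submodule.orthogonal_orthogonal]
      exact hran _
    · rw [hker, Submodule.orthogonal_orthogonal]
      exact hCA x
  · refine ⟨mem_domain_clmToPMap C _, hdom _, mem_domain_clmToPMap C _, ?_⟩
    refine eq_of_sub_mem_orthogonal (mem_pRange _) (hran _) ?_
    have h := (pRange A)ᗮ.sub_mem (hCA x) (hAC x)
    rwa [sub_sub_sub_cancel_left] at h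

theorem stmt_9 (T : H →ₗ.[ℂ] H) (S Td : H →L[ℂ] H)
    (hT : MAccretive T) (hcl : IsClosed ((pRange T : Set H)))
    (hS : CAccretive S) (hTd : IsMoorePenroseInverse T (clmToPMap Td))
    (hRS : LinearMap.range S.toLinearMap ≤ pRange T) (hn : ‖Td * S‖ < 1) :
    pRange (addB T S) = pRange T ∧
    IsClosed ((pRange (addB T S) : Set H)) ∧
    pKer (addB T S) = pKer T ∧
    IsEPPMap (addB T S) ∧
    IsMoorePenroseInverse (addB T S) (clmToPMap (Ring.inverse (1 + Td * S) * Td)) ∧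
    Ring.inverse (1 + Td * S) * Td = Td * Ring.inverse (1 + S * Td) ∧
    Td = (Ring.inverse (1 + Td * S) * Td) * (1 + S * Td) := by
  have : CompleteSpace (pRange T) := hcl.completeSpace_coe
  have hU : IsUnit (1 + Td * S) := by
    have h := isUnit_one_sub_of_norm_lt_one (x := -(Td * S)) (by rwa [norm_neg])
    rwa [sub_neg_eq_add] at h
  have hV : IsUnit (1 + S * Td) := isUnit_one_add_mul_comm hU
  have hcomm : (1 + Td * S) * Td = Td * (1 + S * Td) := by noncomm_ring
  have hCV : Ring.inverse (1 + Td * S) * Td = Td * Ring.inverse (1 + S * Td) := by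
    calc _ = Ring.inverse (1 + Td * S) * (Td * (1 + S * Td)) * Ring.inverse (1 + S * Td) := by
          rw [mul_assoc, mul_assoc, Ring.mul_inverse_cancel _ hV, mul_one]
      _ = _ := by rw [← hcomm, ← mul_assoc, Ring.inverse_mul_cancel _ hU, one_mul]
  have hlast : Td = (Ring.inverse (1 + Td * S) * Td) * (1 + S * Td) := by
    rw [mul_assoc, ← hcomm, ← mul_assoc, Ring.inverse_mul_cancel _ hU, one_mul]
  have hUW (y : H) : Ring.inverse (1 + Td * S) y + Td (S (Ring.inverse (1 + Td * S) y)) = y :=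
    DFunLike.congr_fun (Ring.mul_inverse_cancel _ hU) y
  have hWU (x : H) : Ring.inverse (1 + Td * S) (x + Td (S x)) = x :=
    DFunLike.congr_fun (Ring.inverse_mul_cancel _ hU) x
  have hCapp (y : H) : (Ring.inverse (1 + Td * S) * Td) y = Ring.inverse (1 + Td * S) (Td y) := rfl
  set W := Ring.inverse (1 + Td * S)
  have hK := hT.pKer_eq
  have hSmem (x : H) : S x ∈ pRange T := hRS ⟨x, rfl⟩
  have hSK {z : H} (hz : z ∈ (pRange T)ᗮ) : S z = 0 :=
    hS.apply_eq_zero fun y => (Submodule.mem_orthogonal' _ _).1 hz _ (hSmem y)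
  have hWK {z : H} (hz : z ∈ (pRange T)ᗮ) : W z = z := by
    simpa [hSK hz] using hWU z
  have hD (y : H) : Td y ∈ T.domain := (hTd.proj_range ⟨y, mem_domain_clmToPMap Td y⟩).1
  have hTTd (y : H) : y - T ⟨Td y, hD y⟩ ∈ (pRange T)ᗮ :=
    (hTd.proj_range ⟨y, mem_domain_clmToPMap Td y⟩).2.2
  have hTdT (x : T.domain) : Td (T x) ∈ pRange T ∧ (x : H) - Td (T x) ∈ (pRange T)ᗮ := by
    obtain ⟨_, h1, h2⟩ := hTd.proj_ker x
    rw [hK, Submodule.orthogonal_orthogonal] at h1 h2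
    rw [hcl.submodule_topologicalClosure_eq] at h1
    exact ⟨h1, h2⟩
  have hTdR (y : H) : Td y ∈ pRange T := by
    obtain ⟨_, _, h⟩ := hTd.dtd ⟨y, mem_domain_clmToPMap Td y⟩
    have h' : Td (T ⟨Td y, hD y⟩) = Td y := h
    rw [← h']
    exact (hTdT _).1
  have hUD (x : T.domain) : (x : H) + Td (S x) ∈ T.domain := T.domain.add_mem x.2 (hD _)
  have hA (x : T.domain) : addB T S x = T ⟨x + Td (S x), hUD x⟩ := by
    have h : S x = T ⟨Td (S x), hD _⟩ :=
      eq_of_sub_mem_orthogonal (hSmem _) (mem_pRange _) (hTTd _)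
    rw [addB_apply]
    nth_rw 1 [h]
    rw [← LinearPMap.map_add]
    rfl
  have hWD {y : H} (hy : y ∈ T.domain) : W y ∈ T.domain := by
    rw [eq_sub_of_add_eq (hUW y)]
    exact T.domain.sub_mem hy (hD _)
  have hAW {y : H} (hy : y ∈ T.domain) : addB T S ⟨W y, hWD hy⟩ = T ⟨y, hy⟩ := by
    refine (hA ⟨W y, hWD hy⟩).trans (congrArg T (Subtype.ext ?_))
    exact hUW y
  have hR : pRange (addB T S) = pRange T := by
    apply le_antisymm
    · rintro _ ⟨x, rfl⟩
      exact ⟨_, (hA x).symm⟩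
    · rintro _ ⟨y, rfl⟩
      exact ⟨_, hAW y.2⟩
  have hN : pKer (addB T S) = pKer T := by
    ext z
    constructor
    · intro hz
      obtain ⟨h, hz⟩ := mem_pKer.1 hz
      have hz' := (hA ⟨z, h⟩).symm.trans hz
      have hk : z + Td (S z) ∈ pKer T := mem_pKer.2 ⟨_, hz'⟩
      rw [hK] at hk ⊢
      have h1 := hWK hk
      rw [hWU] at h1
      rwa [h1]
    · intro hz
      obtain ⟨h, h0⟩ := mem_pKer.1 hz
      rw [hK] at hz
      refine mem_pKer.2 ⟨h, (addB_apply T S ⟨z, h⟩).trans ?_⟩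
      rw [h0, hSK hz, add_zero]
  obtain ⟨hMP, hEP⟩ := isMoorePenroseInverse_of_proj (A := addB T S) (C := W * Td)
    (by rwa [hR]) (by rw [hN, hR, hK]) (fun y => hWD (hD y))
    (fun y => by rw [hR, hCV]; exact hTdR _)
    (fun y => by
      rw [hR]
      exact (hAW (hD y)).symm ▸ hTTd y)
    (fun x => by
      rw [hR, hA x, hCapp]
      have h := (hTdT ⟨x + Td (S x), hUD x⟩).2
      have h1 := hWK h
      rw [map_sub, hWU] at h1
      rwa [h1])
  exact ⟨hR, by rwa [hR], hN, ⟨_, hMP, ⟨‖W * Td‖, fun x => (W * Td).le_opNorm x⟩, hEP⟩, hMP,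
    hCV, hlast⟩
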